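/- Let Ω ⊂ ℝⁿ be open and connected and let u ∈ C³(Ω) satisfy Δu = −1 in Ω and ‖∇u(x)‖² + (2/n) u(x) = c² for all x ∈ Ω, where c is a constant. Then D²u(x) = −(1/n) I for every x ∈ Ω, i.e. ∂²u/∂xᵢ∂xⱼ = −δᵢⱼ/n in Ω. -/

import Mathlib

open MeasureTheory Set
open scoped Topology

noncomputable section

/-- The `i`-th standard basis vector of `EuclideanSpace ℝ (Fin n)`. -/
def stdVec (n : ℕ) (i : Fin n) : EuclideanSpace ℝ (Fin n) := EuclideanSpace.single i 1

/-- The second partial derivative `∂²u/∂xᵢ∂xⱼ`. -/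
noncomputable def secondDeriv (n : ℕ) (u : EuclideanSpace ℝ (Fin n) → ℝ) (i j : Fin n)
    (x : EuclideanSpace ℝ (Fin n)) : ℝ :=
  fderiv ℝ (fun y => fderiv ℝ u y (stdVec n j)) x (stdVec n i)

/-- The Euclidean Laplacian `Δu = ∑ i, ∂²u/∂xᵢ²`. -/
noncomputable def lap (n : ℕ) (u : EuclideanSpace ℝ (Fin n) → ℝ)
    (x : EuclideanSpace ℝ (Fin n)) : ℝ :=
  ∑ i, secondDeriv n u i i x

/-- `Ω` has `C^k` boundary: near every boundary point, `Ω` is the sublevel set of a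
`C^k` local defining function with nonvanishing gradient. -/
def HasCkBoundary {n : ℕ} (k : ℕ∞) (Ω : Set (EuclideanSpace ℝ (Fin n))) : Prop :=
  ∀ x ∈ frontier Ω, ∃ (U : Set (EuclideanSpace ℝ (Fin n))) (f : EuclideanSpace ℝ (Fin n) → ℝ),
    IsOpen U ∧ x ∈ U ∧ ContDiffOn ℝ k f U ∧ (∀ y ∈ U, gradient f y ≠ 0) ∧
    Ω ∩ U = {y ∈ U | f y < 0} ∧ frontier Ω ∩ U = {y ∈ U | f y = 0}

/-- `ν` is the outward unit normal vector field on the boundary of `Ω`. -/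
def IsOutwardUnitNormal {n : ℕ} (Ω : Set (EuclideanSpace ℝ (Fin n)))
    (ν : EuclideanSpace ℝ (Fin n) → EuclideanSpace ℝ (Fin n)) : Prop :=
  ∀ x ∈ frontier Ω, ‖ν x‖ = 1 ∧ ∃ ε > 0, ∀ t : ℝ, 0 < t → t < ε →
    x + t • ν x ∉ closure Ω ∧ x - t • ν x ∈ Ω

section DirectionalDerivatives

variable {E : Type*} [NormedAddCommGroup E] [NormedSpace ℝ E] {s : Set E} {f : E → ℝ}

/-- The directional derivative of `f` in the direction `v`. -/
def dirDeriv (v : E) (f : E → ℝ) (x : E) : ℝ := fderiv ℝ f x v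

theorem ContDiffOn.dirDeriv {m k : WithTop ℕ∞} (hf : ContDiffOn ℝ k f s) (hs : IsOpen s)
    (hmk : m + 1 ≤ k) (v : E) : ContDiffOn ℝ m (dirDeriv v f) s :=
  (hf.fderiv_of_isOpen hs hmk).clm_apply contDiffOn_const

theorem dirDeriv_congr_of_isOpen (hs : IsOpen s) {g : E → ℝ} (h : ∀ y ∈ s, f y = g y)
    {x : E} (hx : x ∈ s) (v : E) : dirDeriv v f x = dirDeriv v g x := by
  have : f =ᶠ[𝓝 x] g := Filter.eventuallyEq_of_mem (hs.mem_nhds hx) h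
  simp only [dirDeriv, this.fderiv_eq]

theorem dirDeriv_const (a : ℝ) (v x : E) : dirDeriv v (fun _ : E => a) x = 0 := by
  simp [dirDeriv]

theorem dirDeriv_comm (hs : IsOpen s) (hf : ContDiffOn ℝ 2 f s) {x : E} (hx : x ∈ s) (v w : E) :
    dirDeriv v (dirDeriv w f) x = dirDeriv w (dirDeriv v f) x := by
  have hfx : ContDiffAt ℝ 2 f x := hf.contDiffAt (hs.mem_nhds hx)
  have hd : DifferentiableAt ℝ (fderiv ℝ f) x :=
    (hfx.fderiv_right (m := 1) (by norm_num)).differentiableAt (by norm_num)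
  have key (a b : E) : dirDeriv a (dirDeriv b f) x = fderiv ℝ (fderiv ℝ f) x a b := by
    have := (hd.hasFDerivAt.clm_apply (hasFDerivAt_const b x)).fderiv
    change fderiv ℝ (fun y => fderiv ℝ f y b) x a = _
    rw [this]
    simp
  rw [key, key]
  exact (hfx.isSymmSndFDerivAt (by simp)).eq v w

end DirectionalDerivatives

theorem norm_gradient_sq_eq_sum {n : ℕ} (u : EuclideanSpace ℝ (Fin n) → ℝ)
    (x : EuclideanSpace ℝ (Fin n)) :
    ‖gradient u x‖ ^ 2 = ∑ k, dirDeriv (stdVec n k) u x ^ 2 := by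
  rw [EuclideanSpace.real_norm_sq_eq]
  refine Finset.sum_congr rfl fun k _ => ?_
  have : inner ℝ (gradient u x) (stdVec n k) = dirDeriv (stdVec n k) u x := by
    simp [gradient, dirDeriv]
  rw [← this, stdVec, EuclideanSpace.inner_single_right]
  simp

/-- **Equality case in Weinberger's argument.** If `u ∈ C³(Ω)` on an open connected `Ω ⊆ ℝⁿ`
satisfies `Δu = -1` and `‖∇u‖² + (2/n) u ≡ c²`, then `D²u ≡ -(1/n) I`, i.e.
`∂²u/∂xᵢ∂xⱼ = -δᵢⱼ/n` in `Ω`. -/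
theorem weinberger_equality_case (n : ℕ)
    (Ω : Set (EuclideanSpace ℝ (Fin n))) (hΩo : IsOpen Ω) (hΩconn : IsConnected Ω)
    (u : EuclideanSpace ℝ (Fin n) → ℝ) (hu : ContDiffOn ℝ 3 u Ω)
    (c : ℝ)
    (hpde : ∀ x ∈ Ω, lap n u x = -1)
    (hP : ∀ x ∈ Ω, ‖gradient u x‖ ^ 2 + 2 / n * u x = c ^ 2) :
    ∀ x ∈ Ω, ∀ i j : Fin n,
      secondDeriv n u i j x = -(if i = j then (1 : ℝ) else 0) / n := by
  intro x hx i j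
  have hn : (n : ℝ) ≠ 0 := by
    have := i.pos
    positivity
  set e := stdVec n
  have hu1 (k) : ContDiffOn ℝ 2 (dirDeriv (e k) u) Ω := hu.dirDeriv hΩo (by norm_num) _
  have hu2 (k l) : ContDiffOn ℝ 1 (dirDeriv (e k) (dirDeriv (e l) u)) Ω :=
    (hu1 l).dirDeriv hΩo (by norm_num) _
  have du0 {y} (hy : y ∈ Ω) : DifferentiableAt ℝ u y :=
    (hu.contDiffAt (hΩo.mem_nhds hy)).differentiableAt (by norm_num)
  have du1 (k) {y} (hy : y ∈ Ω) : DifferentiableAt ℝ (dirDeriv (e k) u) y :=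
    ((hu1 k).contDiffAt (hΩo.mem_nhds hy)).differentiableAt (by norm_num)
  have du2 (k l) {y} (hy : y ∈ Ω) :
      DifferentiableAt ℝ (dirDeriv (e k) (dirDeriv (e l) u)) y :=
    ((hu2 k l).contDiffAt (hΩo.mem_nhds hy)).differentiableAt (by norm_num)
  have first (l) : ∀ y ∈ Ω, ∑ k, 2 * (dirDeriv (e k) u y * dirDeriv (e l) (dirDeriv (e k) u) y)
      + 2 / n * dirDeriv (e l) u y = 0 := by
    intro y hy
    have h := dirDeriv_congr_of_isOpen hΩo
      (fun z hz => (norm_gradient_sq_eq_sum u z ▸ hP z hz)) hy (e l)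
    rw [dirDeriv_const] at h
    rw [← h]
    have hd := (HasFDerivAt.fun_sum (u := Finset.univ)
      fun k _ => (du1 k hy).hasFDerivAt.pow 2).add ((du0 hy).hasFDerivAt.const_mul (2 / (n : ℝ)))
    have hd' := congrArg (fun L => L (e l)) hd.fderiv
    refine Eq.trans ?_ hd'.symm
    simp [dirDeriv, mul_assoc]
  have second (l) : ∑ k, 2 * (dirDeriv (e k) u x *
      dirDeriv (e l) (dirDeriv (e l) (dirDeriv (e k) u)) x
      + dirDeriv (e l) (dirDeriv (e k) u) x ^ 2)
      + 2 / n * dirDeriv (e l) (dirDeriv (e l) u) x = 0 := by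
    have h := dirDeriv_congr_of_isOpen hΩo (first l) hx (e l)
    rw [dirDeriv_const] at h
    rw [← h]
    have hd := (HasFDerivAt.fun_sum (u := Finset.univ)
      fun k _ => ((du1 k hx).hasFDerivAt.mul (du2 l k hx).hasFDerivAt).const_mul 2).add
        ((du1 l hx).hasFDerivAt.const_mul (2 / (n : ℝ)))
    have hd' := congrArg (fun L => L (e l)) hd.fderiv
    refine Eq.trans ?_ hd'.symm
    simp [dirDeriv, pow_two, mul_add]
  have lap_x : ∑ l, dirDeriv (e l) (dirDeriv (e l) u) x = -1 := hpde x hx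
  have third (k) : ∑ l, dirDeriv (e l) (dirDeriv (e l) (dirDeriv (e k) u)) x = 0 := by
    have h := dirDeriv_congr_of_isOpen hΩo hpde hx (e k)
    rw [dirDeriv_const] at h
    rw [← h]
    have hd := HasFDerivAt.fun_sum (u := Finset.univ) fun l _ => (du2 l l hx).hasFDerivAt
    have hd' := congrArg (fun L => L (e k)) hd.fderiv
    refine Eq.trans ?_ hd'.symm
    rw [sum_apply]
    refine Finset.sum_congr rfl fun l _ => ?_
    rw [dirDeriv_congr_of_isOpen hΩo
      (fun y hy => dirDeriv_comm hΩo (hu.of_le (by norm_num)) hy (e l) (e k)) hx,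
      dirDeriv_comm hΩo (hu1 l) hx]
    rfl
  have hess : ∑ l, ∑ k, dirDeriv (e l) (dirDeriv (e k) u) x ^ 2 = 1 / n := by
    have h : ∑ l, (∑ k, 2 * (dirDeriv (e k) u x *
        dirDeriv (e l) (dirDeriv (e l) (dirDeriv (e k) u)) x
        + dirDeriv (e l) (dirDeriv (e k) u) x ^ 2)
        + 2 / n * dirDeriv (e l) (dirDeriv (e l) u) x) = 0 :=
      Finset.sum_eq_zero fun l _ => second l
    have h0 : ∑ l, ∑ k, dirDeriv (e k) u x *
        dirDeriv (e l) (dirDeriv (e l) (dirDeriv (e k) u)) x = 0 := by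
      rw [Finset.sum_comm]
      simp [← Finset.mul_sum, third]
    simp only [Finset.sum_add_distrib, ← Finset.mul_sum] at h
    rw [h0, lap_x] at h
    linear_combination h / 2
  have sq_sum : ∑ l, ∑ k,
      (dirDeriv (e l) (dirDeriv (e k) u) x + (if l = k then (1 : ℝ) else 0) / n) ^ 2 = 0 := by
    have expand (l k : Fin n) :
        (dirDeriv (e l) (dirDeriv (e k) u) x + (if l = k then (1 : ℝ) else 0) / n) ^ 2 =
        dirDeriv (e l) (dirDeriv (e k) u) x ^ 2 +
        if l = k then 2 / n * dirDeriv (e l) (dirDeriv (e k) u) x + 1 / (n : ℝ) ^ 2 else 0 := by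
      split_ifs <;> ring
    simp only [expand, Finset.sum_add_distrib, Finset.sum_ite_eq, Finset.mem_univ, if_true, hess,
      ← Finset.mul_sum, lap_x, Finset.sum_const, Finset.card_univ, Fintype.card_fin, nsmul_eq_mul]
    field_simp
    ring
  have hl := (Finset.sum_eq_zero_iff_of_nonneg fun l _ =>
    Finset.sum_nonneg fun k _ => sq_nonneg _).1 sq_sum i (Finset.mem_univ i)
  have hk := (Finset.sum_eq_zero_iff_of_nonneg fun k _ => sq_nonneg _).1 hl j (Finset.mem_univ j)
  have : dirDeriv (e i) (dirDeriv (e j) u) x = -(if i = j then (1 : ℝ) else 0) / n := by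
    linear_combination pow_eq_zero_iff (two_ne_zero) |>.1 hk
  exact this
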